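/- For all real numbers a, b > 0 with a ≠ b, the inequality α₀·(Q(a,b)/3 + 2·A(a,b)/3) + (1-α₀)·Q(a,b)^{1/3}·A(a,b)^{2/3} < M(a,b) holds, where α₀ = (3 - 3·2^{1/6}·log(1+√2)) / ((2 + √2 - 3·2^{1/6})·log(1+√2)). -/

import Mathlib

noncomputable def M (a b : ℝ) : ℝ := (a - b) / (2 * Real.arsinh ((a - b) / (a + b)))
noncomputable def A (a b : ℝ) : ℝ := (a + b) / 2
noncomputable def Q (a b : ℝ) : ℝ := Real.sqrt ((a ^ 2 + b ^ 2) / 2)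

open Real Set

namespace NeumanSandor

/-- The lower bound for the Neuman–Sándor mean in the variable `t = (Q / A) ^ (1 / 3)`, with
the means normalized by `A = 1`. -/
noncomputable def combo (α t : ℝ) : ℝ := α * (t ^ 3 / 3 + 2 / 3) + (1 - α) * t

/-- The factor carrying the sign of the derivative of `gap`. -/
noncomputable def signFactor (α t : ℝ) : ℝ :=
  (1 + 2 * t + 3 * t ^ 2 + 4 * t ^ 3 + 2 * t ^ 4)
    - α * (1 + 2 * t + 2 * t ^ 2 + 6 * t ^ 3 + 4 * t ^ 4)
    + α ^ 2 * (-4 / 3 * t ^ 2 + 4 / 3 * t ^ 3 + t ^ 4 - 2 / 3 * t ^ 5 - 1 / 3 * t ^ 6)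

noncomputable def gap (α t : ℝ) : ℝ := √(t ^ 6 - 1) / combo α t - arsinh √(t ^ 6 - 1)

lemma combo_pos {α t : ℝ} (hα : 0 ≤ α) (ht : 1 ≤ t) : 0 < combo α t := by
  have h : combo α t = α * ((t - 1) ^ 2 * (t + 2) / 3) + t := by unfold combo; ring
  rw [h]
  positivity

lemma signFactor_strictAntiOn {α : ℝ} (hα : 18 / 25 < α) :
    StrictAntiOn (signFactor α) (Ici 1) := by
  refine strictAntiOn_of_hasDerivWithinAt_neg (convex_Ici 1)
    (f' := fun t ↦ (2 + 6 * t + 12 * t ^ 2 + 8 * t ^ 3)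
      - α * (2 + 4 * t + 18 * t ^ 2 + 16 * t ^ 3)
      + α ^ 2 * (-8 / 3 * t + 4 * t ^ 2 + 4 * t ^ 3 - 10 / 3 * t ^ 4 - 2 * t ^ 5)) ?_ ?_ ?_
  · unfold signFactor
    fun_prop
  · intro t _
    refine HasDerivAt.hasDerivWithinAt ?_
    have h (n : ℕ) := hasDerivAt_pow n t
    have h₁ := hasDerivAt_id t
    have h₀ := (((((h₁.const_mul 2).const_add 1).add ((h 2).const_mul 3)).add
      ((h 3).const_mul 4)).add ((h 4).const_mul 2)).sub
      ((((((h₁.const_mul 2).const_add 1).add ((h 2).const_mul 2)).add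
      ((h 3).const_mul 6)).add ((h 4).const_mul 4)).const_mul α) |>.add
      (((((((h 2).const_mul (-4 / 3)).add ((h 3).const_mul (4 / 3))).add (h 4)).sub
      ((h 5).const_mul (2 / 3))).sub ((h 6).const_mul (1 / 3))).const_mul (α ^ 2))
    refine h₀.congr_deriv ?_
    push_cast
    ring
  · intro t ht
    rw [interior_Ici, mem_Ioi] at ht
    obtain ⟨s, hs, rfl⟩ : ∃ s, 0 < s ∧ t = 1 + s := ⟨t - 1, by linarith, by ring⟩
    have hlin : 18 / 25 * (2 + 4 * (1 + s) + 18 * (1 + s) ^ 2 + 16 * (1 + s) ^ 3) <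
        α * (2 + 4 * (1 + s) + 18 * (1 + s) ^ 2 + 16 * (1 + s) ^ 3) :=
      mul_lt_mul_of_pos_right hα (by positivity)
    have hquad : α ^ 2 * (-8 / 3 * (1 + s) + 4 * (1 + s) ^ 2 + 4 * (1 + s) ^ 3
        - 10 / 3 * (1 + s) ^ 4 - 2 * (1 + s) ^ 5) ≤ 0 := by
      refine mul_nonpos_of_nonneg_of_nonpos (by positivity) ?_
      have := pow_pos hs 2
      have := pow_pos hs 3
      have := pow_pos hs 4
      have := pow_pos hs 5
      nlinarith
    have := pow_pos hs 2
    have := pow_pos hs 3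
    nlinarith

lemma hasDerivAt_gap {α t : ℝ} (hα : 0 ≤ α) (ht : 1 < t) :
    HasDerivAt (gap α)
      ((t - 1) ^ 2 / (√(t ^ 6 - 1) * combo α t ^ 2) * signFactor α t) t := by
  have ht6 : 0 < t ^ 6 - 1 := sub_pos.2 (one_lt_pow₀ ht (by norm_num))
  have hP := combo_pos hα ht.le
  have hx : 0 < √(t ^ 6 - 1) := sqrt_pos.2 ht6
  have hx2 : √(t ^ 6 - 1) ^ 2 = t ^ 6 - 1 := sq_sqrt ht6.le
  have hsqrt : HasDerivAt (fun t : ℝ ↦ √(t ^ 6 - 1)) (6 * t ^ 5 / (2 * √(t ^ 6 - 1))) t := by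
    simpa using ((hasDerivAt_pow 6 t).sub_const 1).sqrt ht6.ne'
  have hcombo : HasDerivAt (combo α) (α * t ^ 2 + (1 - α)) t := by
    refine ((((hasDerivAt_pow 3 t).div_const 3).add_const (2 / 3)).const_mul α |>.add
      ((hasDerivAt_id t).const_mul (1 - α))).congr_deriv ?_
    push_cast
    ring
  have hroot : √(1 + √(t ^ 6 - 1) ^ 2) = t ^ 3 := by
    rw [hx2, show 1 + (t ^ 6 - 1) = (t ^ 3) ^ 2 by ring, sqrt_sq (by positivity)]
  refine ((hsqrt.div hcombo hP.ne').sub hsqrt.arsinh).congr_deriv ?_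
  rw [hroot, smul_eq_mul]
  have ht0 : t ≠ 0 := by positivity
  field_simp
  rw [hx2]
  unfold combo signFactor
  ring

lemma continuousOn_gap {α : ℝ} (hα : 0 ≤ α) : ContinuousOn (gap α) (Ici 1) := by
  refine ContinuousOn.sub (ContinuousOn.div (by fun_prop) (by unfold combo; fun_prop)
    fun t ht ↦ (combo_pos hα ht).ne') ?_
  exact (continuous_arsinh.comp (by fun_prop : Continuous fun t : ℝ ↦ √(t ^ 6 - 1))).continuousOn

lemma gap_pos {α c t : ℝ} (hα : 18 / 25 < α) (hc : gap α c = 0) (ht : 1 < t) (htc : t < c) :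
    0 < gap α t := by
  have hα0 : 0 ≤ α := by linarith
  have hcont := continuousOn_gap hα0
  have h1 : gap α 1 = 0 := by simp [gap]
  by_contra! hneg
  obtain ⟨r, ⟨hr1, hrt⟩, hr⟩ := exists_hasDerivAt_eq_slope (gap α) _ ht
    (hcont.mono Icc_subset_Ici_self) fun y hy ↦ hasDerivAt_gap hα0 hy.1
  obtain ⟨s, ⟨hts, hsc⟩, hs⟩ := exists_hasDerivAt_eq_slope (gap α) _ htc
    (hcont.mono fun y hy ↦ ht.le.trans hy.1) fun y hy ↦ hasDerivAt_gap hα0 (ht.trans hy.1)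
  have hweight {y : ℝ} (hy : 1 < y) : 0 < (y - 1) ^ 2 / (√(y ^ 6 - 1) * combo α y ^ 2) := by
    have := combo_pos hα0 hy.le
    have : 0 < √(y ^ 6 - 1) := sqrt_pos.2 (sub_pos.2 (one_lt_pow₀ hy (by norm_num)))
    have : 0 < y - 1 := sub_pos.2 hy
    positivity
  have hs1 : 1 < s := ht.trans hts
  have hGr : signFactor α r ≤ 0 := by
    refine nonpos_of_mul_nonpos_right (hr.trans_le ?_) (hweight hr1)
    exact div_nonpos_of_nonpos_of_nonneg (by linarith) (by linarith)
  have hGs : 0 ≤ signFactor α s := by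
    refine nonneg_of_mul_nonneg_right ?_ (hweight hs1)
    rw [hs]
    exact div_nonneg (by linarith) (by linarith)
  have := signFactor_strictAntiOn hα (mem_Ici.2 hr1.le) (mem_Ici.2 hs1.le) (hrt.trans hts)
  linarith

lemma log_one_add_sqrt_two_lt : log (1 + √2) < 1763 / 2000 := by
  rw [log_lt_iff_lt_exp (by positivity)]
  have h2 : √2 < 1.41422 := by
    rw [sqrt_lt' (by norm_num)]
    norm_num
  have h := sum_le_exp_of_nonneg (x := 1763 / 2000) (by norm_num) 9
  norm_num [Finset.sum_range_succ, Nat.factorial] at h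
  norm_num at h2
  linarith

/-- The constant for which the two sides agree at `t = 2 ^ (1 / 6)`. -/
noncomputable def optimalWeight : ℝ :=
  (3 - 3 * (2 : ℝ) ^ ((1 : ℝ) / 6) * log (1 + √2)) /
    ((2 + √2 - 3 * (2 : ℝ) ^ ((1 : ℝ) / 6)) * log (1 + √2))

lemma two_rpow_sixth_pow_six : ((2 : ℝ) ^ ((1 : ℝ) / 6)) ^ 6 = 2 := by
  rw [← rpow_natCast, ← rpow_mul (by norm_num)]
  norm_num

lemma two_rpow_sixth_pow_three : ((2 : ℝ) ^ ((1 : ℝ) / 6)) ^ 3 = √2 := by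
  rw [← rpow_natCast, ← rpow_mul (by norm_num), sqrt_eq_rpow]
  norm_num

lemma two_rpow_sixth_lt : (2 : ℝ) ^ ((1 : ℝ) / 6) < 449 / 400 := by
  refine lt_of_pow_lt_pow_left₀ 6 (by norm_num) ?_
  rw [two_rpow_sixth_pow_six]
  norm_num

lemma log_one_add_sqrt_two_pos : 0 < log (1 + √2) :=
  log_pos (lt_add_of_pos_right 1 (by positivity))

lemma two_add_sqrt_two_sub_pos : 0 < 2 + √2 - 3 * (2 : ℝ) ^ ((1 : ℝ) / 6) := by
  have h2 : 1.414 < √2 := by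
    rw [lt_sqrt (by norm_num)]
    norm_num
  have := two_rpow_sixth_lt
  norm_num at h2
  linarith

lemma lt_optimalWeight : 18 / 25 < optimalWeight := by
  have hL := log_one_add_sqrt_two_pos
  have hL' := log_one_add_sqrt_two_lt
  have hD := two_add_sqrt_two_sub_pos
  have hc := two_rpow_sixth_lt
  have h2 : √2 < 70711 / 50000 := by
    rw [sqrt_lt' (by norm_num)]
    norm_num
  rw [optimalWeight, lt_div_iff₀ (by positivity)]
  have : log (1 + √2) * (18 / 25 * (2 + √2) + 21 / 25 * (2 : ℝ) ^ ((1 : ℝ) / 6)) <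
      1763 / 2000 * (18 / 25 * (2 + 70711 / 50000) + 21 / 25 * (449 / 400)) := by
    gcongr
  linarith

lemma gap_optimalWeight : gap optimalWeight ((2 : ℝ) ^ ((1 : ℝ) / 6)) = 0 := by
  have hL := log_one_add_sqrt_two_pos
  have hD := two_add_sqrt_two_sub_pos
  have hcombo : combo optimalWeight ((2 : ℝ) ^ ((1 : ℝ) / 6)) = 1 / log (1 + √2) := by
    rw [combo, two_rpow_sixth_pow_three, optimalWeight]
    field_simp
    ring
  rw [gap, hcombo, two_rpow_sixth_pow_six]
  norm_num [arsinh]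

lemma combo_lt_div_arsinh {u : ℝ} (hu0 : 0 < u) (hu1 : u < 1) :
    combo optimalWeight ((1 + u ^ 2) ^ ((1 : ℝ) / 6)) < u / arsinh u := by
  set t : ℝ := (1 + u ^ 2) ^ ((1 : ℝ) / 6) with ht
  have ht1 : 1 < t := one_lt_rpow (by nlinarith) (by norm_num)
  have ht2 : t < (2 : ℝ) ^ ((1 : ℝ) / 6) :=
    rpow_lt_rpow (by positivity) (by nlinarith) (by norm_num)
  have ht6 : √(t ^ 6 - 1) = u := by
    have : t ^ 6 = 1 + u ^ 2 := by
      rw [ht, ← rpow_natCast, ← rpow_mul (by positivity)]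
      norm_num
    rw [this, add_sub_cancel_left, sqrt_sq hu0.le]
  have hgap := gap_pos lt_optimalWeight gap_optimalWeight ht1 ht2
  have hP := combo_pos (α := optimalWeight) (by linarith [lt_optimalWeight]) ht1.le
  rw [gap, ht6, sub_pos, lt_div_iff₀ hP] at hgap
  rwa [lt_div_iff₀ (arsinh_pos_iff.2 hu0), mul_comm]

lemma Q_eq_A_mul {a b : ℝ} (ha : 0 < a) (hb : 0 < b) :
    Q a b = A a b * √(1 + ((a - b) / (a + b)) ^ 2) := by
  have hA : 0 < A a b := by unfold A; positivity
  nth_rw 1 [← sqrt_sq hA.le]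
  rw [Q, ← sqrt_mul (sq_nonneg _), A]
  congr 1
  field_simp
  ring

lemma M_eq_A_mul {a b : ℝ} (ha : 0 < a) (hb : 0 < b) :
    M a b = A a b * (|(a - b) / (a + b)| / arsinh |(a - b) / (a + b)|) := by
  have habs : |(a - b) / (a + b)| / arsinh |(a - b) / (a + b)| =
      (a - b) / (a + b) / arsinh ((a - b) / (a + b)) := by
    rcases abs_choice ((a - b) / (a + b)) with h | h <;> rw [h]
    rw [arsinh_neg, neg_div_neg_eq]
  rw [habs, M, A]
  field_simp

end NeumanSandor

open NeumanSandor

theorem stmt_0 (a b : ℝ) (ha : 0 < a) (hb : 0 < b) (hab : a ≠ b) :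
    (3 - 3 * (2 : ℝ) ^ ((1 : ℝ)/6) * Real.log (1 + Real.sqrt 2)) /
      ((2 + Real.sqrt 2 - 3 * (2 : ℝ) ^ ((1 : ℝ)/6)) * Real.log (1 + Real.sqrt 2)) *
      (Q a b / 3 + 2 * A a b / 3) +
    (1 - (3 - 3 * (2 : ℝ) ^ ((1 : ℝ)/6) * Real.log (1 + Real.sqrt 2)) /
      ((2 + Real.sqrt 2 - 3 * (2 : ℝ) ^ ((1 : ℝ)/6)) * Real.log (1 + Real.sqrt 2))) *
      (Q a b ^ ((1 : ℝ)/3) * A a b ^ ((2 : ℝ)/3)) < M a b := by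
  change optimalWeight * (Q a b / 3 + 2 * A a b / 3) +
    (1 - optimalWeight) * (Q a b ^ ((1 : ℝ)/3) * A a b ^ ((2 : ℝ)/3)) < M a b
  have hA : 0 < A a b := by unfold A; positivity
  set u := (a - b) / (a + b) with hu
  have hu0 : 0 < |u| := abs_pos.2 (div_ne_zero (sub_ne_zero.2 hab) (by positivity))
  have hu1 : |u| < 1 := by
    rw [hu, abs_lt, lt_div_iff₀ (by positivity), div_lt_one (by positivity)]
    constructor <;> linarith
  have hlt := mul_lt_mul_of_pos_left (combo_lt_div_arsinh hu0 hu1) hA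
  rw [← M_eq_A_mul ha hb, sq_abs] at hlt
  have hpos : (0 : ℝ) < 1 + u ^ 2 := by positivity
  have hcube : ((1 + u ^ 2) ^ ((1 : ℝ) / 6)) ^ 3 = √(1 + u ^ 2) := by
    rw [← rpow_natCast, ← rpow_mul hpos.le, sqrt_eq_rpow]
    norm_num
  have hgeom : Q a b ^ ((1 : ℝ)/3) * A a b ^ ((2 : ℝ)/3) =
      A a b * (1 + u ^ 2) ^ ((1 : ℝ) / 6) := by
    rw [Q_eq_A_mul ha hb, mul_rpow hA.le (sqrt_nonneg _), mul_right_comm, ← rpow_add hA,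
      sqrt_eq_rpow, ← rpow_mul hpos.le]
    norm_num [hu]
  rw [hgeom, Q_eq_A_mul ha hb]
  rw [combo, hcube] at hlt
  linarith
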